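/- arXiv:2111.00259 — 2 statements merged into one kernel-verified Lean document; each statement's English description precedes it below -/
import Mathlib

section
/- Let π be a valid abelian border array of length n − 1 ≥ 1, and let S be the set of all non-negative integers k such that the length-n array obtained by appending k to π is a valid abelian border array of length n. Then S has exactly two elements. Moreover, if x is the generating word of π with x[1] = 0, then S = { n − 1, π_{x1}[n] }, where x1 denotes x with the letter 1 appended. -/
/-- Number of ones among positions `a, a+1, …, b-1` (0-indexed) of the binary word `x`. -/
def onesIn (x : ℕ → Bool) (a b : ℕ) : ℕ :=
  ((Finset.Ico a b).filter (fun i => x i = true)).card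

/-- The length-`k` prefix of the length-`m` word `x[0..m-1]` is an abelian border of it:
it is a proper prefix (`k < m`) whose number of ones equals that of the length-`k` suffix. -/
def IsAbelianBorder (x : ℕ → Bool) (m k : ℕ) : Prop :=
  k < m ∧ onesIn x 0 k = onesIn x (m - k) m

/-- `abArray x i` is the length of the longest abelian border of the prefix `x[0..i-1]`
(the entry `π_x[i]` of the abelian border array, in 1-indexed notation). -/
noncomputable def abArray (x : ℕ → Bool) (i : ℕ) : ℕ :=
  sSup {k | IsAbelianBorder x i k}
/-- The abelian border array of a binary word of length `n` given as `x : Fin n → Bool`: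
`abVec x i` is the length of the longest abelian border of the prefix of length `i+1`,
i.e. the entry `π_x[i+1]` in 1-indexed notation. -/
noncomputable def abVec {n : ℕ} (x : Fin n → Bool) : Fin n → ℕ :=
  fun i => abArray (fun j => if h : j < n then x ⟨j, h⟩ else false) (i.1 + 1)

theorem onesIn_congr {x y : ℕ → Bool} {a b : ℕ} (h : ∀ j < b, x j = y j) :
    onesIn x a b = onesIn y a b := by
  unfold onesIn
  congr 1
  refine Finset.filter_congr fun j hj => ?_
  rw [h j (Finset.mem_Ico.1 hj).2]

theorem abArray_congr {x y : ℕ → Bool} {m : ℕ} (h : ∀ j < m, x j = y j) :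
    abArray x m = abArray y m := by
  unfold abArray
  congr 1
  ext k
  refine and_congr_right fun hk => ?_
  rw [onesIn_congr fun j hj => h j (hj.trans hk), onesIn_congr (a := m - k) h]

theorem onesIn_not_add (x : ℕ → Bool) (a b : ℕ) :
    onesIn (fun j => !x j) a b + onesIn x a b = b - a := by
  have h := Finset.card_filter_add_card_filter_not (s := Finset.Ico a b) (fun j => x j = true)
  rw [Nat.card_Ico] at h
  simp only [onesIn, Bool.not_eq_true', ← Bool.not_eq_true]
  omega

theorem abArray_not (x : ℕ → Bool) (m : ℕ) : abArray (fun j => !x j) m = abArray x m := by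
  unfold abArray
  congr 1
  ext k
  refine and_congr_right fun hk => ?_
  have h₁ := onesIn_not_add x 0 k
  have h₂ := onesIn_not_add x (m - k) m
  omega

theorem isAbelianBorder_succ_iff (x : ℕ → Bool) (m : ℕ) :
    IsAbelianBorder x (m + 1) m ↔ x m = x 0 := by
  have h₁ : onesIn x 0 (m + 1) = onesIn x 0 m + (x m).toNat := by
    simp only [onesIn, Finset.card_filter]
    rw [Finset.sum_Ico_succ_top (Nat.zero_le m)]
    cases x m <;> simp
  have h₂ : onesIn x 0 (m + 1) = (x 0).toNat + onesIn x 1 (m + 1) := by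
    simp only [onesIn, Finset.card_filter]
    rw [Finset.sum_eq_sum_Ico_succ_bot (Nat.succ_pos m)]
    cases x 0 <;> simp
  unfold IsAbelianBorder
  rw [Nat.add_sub_cancel_left]
  cases hm : x m <;> cases h0 : x 0 <;> simp only [hm, h0, Bool.toNat_true, Bool.toNat_false]
    at h₁ h₂ <;> simp <;> omega

/-- The array takes its maximal value at a position exactly when the letter there is the first
letter of the word. -/
theorem abArray_succ_eq_iff (x : ℕ → Bool) (m : ℕ) : abArray x (m + 1) = m ↔ x m = x 0 := by
  rw [← isAbelianBorder_succ_iff]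
  have hub : m ∈ upperBounds {k | IsAbelianBorder x (m + 1) k} :=
    fun k hk => Nat.lt_succ_iff.1 hk.1
  constructor
  · intro h
    have hmem : abArray x (m + 1) ∈ {k | IsAbelianBorder x (m + 1) k} :=
      Nat.sSup_mem ⟨0, Nat.succ_pos m, by simp [onesIn]⟩ ⟨m, hub⟩
    rwa [h] at hmem
  · intro h
    exact IsGreatest.csSup_eq ⟨h, hub⟩

theorem abVec_congr {m n : ℕ} {x : Fin m → Bool} {y : Fin n → Bool} {i : ℕ} (hm : i < m)
    (hn : i < n)
    (h : ∀ j (hj : j ≤ i), x ⟨j, hj.trans_lt hm⟩ = y ⟨j, hj.trans_lt hn⟩) :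
    abVec x ⟨i, hm⟩ = abVec y ⟨i, hn⟩ := by
  refine abArray_congr fun j hj => ?_
  have hj' : j ≤ i := Nat.lt_succ_iff.1 hj
  simp only [hj'.trans_lt hm, hj'.trans_lt hn, dite_true, h j hj']

theorem abVec_not {n : ℕ} (x : Fin n → Bool) : abVec (fun i => !x i) = abVec x := by
  funext i
  refine Eq.trans (abArray_congr fun j hj => ?_) (abArray_not _ _)
  have hj' : j < n := by omega
  simp only [hj', dite_true]

theorem abVec_eq_iff {n : ℕ} (x : Fin n → Bool) (i : ℕ) (hi : i < n) :
    abVec x ⟨i, hi⟩ = i ↔ x ⟨i, hi⟩ = x ⟨0, by omega⟩ := by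
  have hn : 0 < n := by omega
  refine (abArray_succ_eq_iff _ i).trans ?_
  simp only [hi, hn, dite_true]

/-- A word starting with `false` is determined by its abelian border array. -/
theorem eq_of_abVec_eq {m n : ℕ} {x : Fin m → Bool} {y : Fin n → Bool} {i : ℕ} (hm : i < m)
    (hn : i < n) (hx : x ⟨0, by omega⟩ = false) (hy : y ⟨0, by omega⟩ = false)
    (h : abVec x ⟨i, hm⟩ = abVec y ⟨i, hn⟩) : x ⟨i, hm⟩ = y ⟨i, hn⟩ := by
  have hxi := abVec_eq_iff x i hm
  rw [h, abVec_eq_iff y i hn, hx, hy] at hxi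
  cases hxv : x ⟨i, hm⟩ <;> cases hyv : y ⟨i, hn⟩ <;> simp_all

/-- Let `π` be a valid abelian border array of length `n - 1 ≥ 1` with generating word
`x` satisfying `x[1] = 0`, and let `S` be the set of all `k` such that appending `k`
to `π` yields a valid abelian border array of length `n`.  Then `|S| = 2`; moreover
`S = {n - 1, π_{x1}[n]}`, where `x1` is `x` with the letter `1` appended. -/
theorem stmt_3 (n : ℕ) (hn : 2 ≤ n) (π : Fin (n - 1) → ℕ)
    (x : Fin (n - 1) → Bool) (hgen : abVec x = π)
    (hx1 : x ⟨0, by omega⟩ = false) :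
    {k : ℕ | ∃ y : Fin n → Bool,
        (∀ i : Fin (n - 1), abVec y ⟨i.1, lt_of_lt_of_le i.2 (Nat.sub_le n 1)⟩ = π i) ∧
        abVec y ⟨n - 1, by omega⟩ = k}.ncard = 2 ∧
    {k : ℕ | ∃ y : Fin n → Bool,
        (∀ i : Fin (n - 1), abVec y ⟨i.1, lt_of_lt_of_le i.2 (Nat.sub_le n 1)⟩ = π i) ∧
        abVec y ⟨n - 1, by omega⟩ = k} =
      {n - 1,
       abVec (fun i : Fin n => if h : i.1 < n - 1 then x ⟨i.1, h⟩ else true)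
         ⟨n - 1, by omega⟩} := by
  subst hgen
  have snoc_abVec (b : Bool) (i : Fin (n - 1)) :
      abVec (fun i : Fin n => if h : i.1 < n - 1 then x ⟨i.1, h⟩ else b)
        ⟨i.1, lt_of_lt_of_le i.2 (Nat.sub_le n 1)⟩ = abVec x i := by
    refine abVec_congr _ i.2 fun j hj => ?_
    have hj' : j < n - 1 := by omega
    simp only [hj', dite_true]
  have h0 : 0 < n - 1 := by omega
  have key : {k : ℕ | ∃ y : Fin n → Bool,
        (∀ i : Fin (n - 1), abVec y ⟨i.1, lt_of_lt_of_le i.2 (Nat.sub_le n 1)⟩ = abVec x i) ∧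
        abVec y ⟨n - 1, by omega⟩ = k} =
      {n - 1,
       abVec (fun i : Fin n => if h : i.1 < n - 1 then x ⟨i.1, h⟩ else true)
         ⟨n - 1, by omega⟩} := by
    ext k
    simp only [Set.mem_ofPred_eq, Set.mem_insert_iff, Set.mem_singleton_iff]
    constructor
    · rintro ⟨y, hy, rfl⟩
      wlog hy0 : y ⟨0, by omega⟩ = false generalizing y
      · rw [← abVec_not y] at hy ⊢
        exact this _ hy (by simpa using hy0)
      by_cases hlast : y ⟨n - 1, by omega⟩ = false
      · exact Or.inl ((abVec_eq_iff y _ _).2 (hlast.trans hy0.symm))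
      · refine Or.inr (abVec_congr _ _ fun j hj => ?_)
        split_ifs with hj'
        · exact eq_of_abVec_eq _ hj' hy0 hx1 (hy ⟨j, hj'⟩)
        · obtain rfl : j = n - 1 := le_antisymm hj (not_lt.1 hj')
          simpa using hlast
    · rintro (rfl | rfl)
      · refine ⟨_, snoc_abVec false, (abVec_eq_iff _ _ _).2 ?_⟩
        simp [h0, hx1]
      · exact ⟨_, snoc_abVec true, rfl⟩
  refine ⟨?_, key⟩
  rw [key]
  refine Set.ncard_pair fun h => ?_
  have := (abVec_eq_iff _ _ _).1 h.symm
  simp [h0, hx1] at this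
end

section
/- For every n ≥ 1, the number T_n of distinct valid abelian border arrays of length n (over the binary alphabet) equals 2^{n−1}. Equivalently, the set { π_x : x a binary word of length n } has cardinality 2^{n−1}. -/
theorem onesIn_succ_right (x : ℕ → Bool) {a b : ℕ} (h : a ≤ b) :
    onesIn x a (b + 1) = onesIn x a b + (x b).toNat := by
  unfold onesIn
  rw [Finset.card_filter, Finset.card_filter, Finset.sum_Ico_succ_top h]
  cases x b <;> simp

theorem onesIn_eq_add_succ_left (x : ℕ → Bool) {a b : ℕ} (h : a < b) :
    onesIn x a b = (x a).toNat + onesIn x (a + 1) b := by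
  unfold onesIn
  rw [Finset.card_filter, Finset.card_filter, Finset.sum_eq_sum_Ico_succ_bot h]
  cases x a <;> simp

theorem onesIn_add_onesIn_of_compl {x y : ℕ → Bool} {a b : ℕ}
    (h : ∀ i < b, y i = !x i) : onesIn x a b + onesIn y a b = b - a := by
  have hy : onesIn y a b = ((Finset.Ico a b).filter (fun i => ¬ x i = true)).card := by
    unfold onesIn
    congr 1
    refine Finset.filter_congr fun i hi => ?_
    simp [h i (Finset.mem_Ico.mp hi).2]
  rw [hy, onesIn, Finset.card_filter_add_card_filter_not, Nat.card_Ico]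

theorem isAbelianBorder_compl_iff {x y : ℕ → Bool} {m k : ℕ} (h : ∀ i < m, y i = !x i) :
    IsAbelianBorder y m k ↔ IsAbelianBorder x m k := by
  unfold IsAbelianBorder
  refine and_congr_right fun hk => ?_
  have h₁ := onesIn_add_onesIn_of_compl (a := 0) (b := k) fun i hi => h i (hi.trans hk)
  have h₂ := onesIn_add_onesIn_of_compl (a := m - k) h
  omega

theorem abArray_compl {x y : ℕ → Bool} {m : ℕ} (h : ∀ i < m, y i = !x i) :
    abArray y m = abArray x m := by
  simp only [abArray, isAbelianBorder_compl_iff h]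

/-- A nonempty word has an abelian border of maximal length exactly when
its first and last letters agree. -/
theorem isAbelianBorder_succ_self_iff (x : ℕ → Bool) (m : ℕ) :
    IsAbelianBorder x (m + 1) m ↔ x 0 = x m := by
  have h₁ := onesIn_succ_right x (Nat.zero_le m)
  have h₂ := onesIn_eq_add_succ_left x (Nat.add_one_pos m)
  simp only [IsAbelianBorder, Nat.add_sub_cancel_left, Nat.lt_add_one, true_and]
  rw [zero_add] at h₂
  cases hx : x 0 <;> cases hy : x m <;> simp [hx, hy] at * <;> omega

theorem abArray_succ_eq_self_iff (x : ℕ → Bool) (m : ℕ) :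
    abArray x (m + 1) = m ↔ x 0 = x m := by
  rw [← isAbelianBorder_succ_self_iff]
  have hb : m ∈ upperBounds {k | IsAbelianBorder x (m + 1) k} :=
    fun k hk => Nat.lt_succ_iff.mp hk.1
  constructor
  · intro h
    have hmem : abArray x (m + 1) ∈ {k | IsAbelianBorder x (m + 1) k} :=
      Nat.sSup_mem ⟨0, by simp [IsAbelianBorder, onesIn]⟩ ⟨m, hb⟩
    rwa [h] at hmem
  · intro h
    exact IsGreatest.csSup_eq ⟨h, hb⟩

theorem abVec_eq_self_iff {n : ℕ} (x : Fin (n + 1) → Bool) (i : Fin (n + 1)) :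
    abVec x i = i ↔ x 0 = x i := by
  rw [abVec, abArray_succ_eq_self_iff]
  simp [Nat.le_of_lt_succ i.isLt]

theorem abVec_cons_false_injective (n : ℕ) :
    Function.Injective fun t : Fin n → Bool => abVec (Fin.cons false t : Fin (n + 1) → Bool) := by
  intro s t h
  funext i
  have hs := abVec_eq_self_iff (Fin.cons false s : Fin (n + 1) → Bool) i.succ
  have ht := abVec_eq_self_iff (Fin.cons false t : Fin (n + 1) → Bool) i.succ
  have hst : abVec (Fin.cons false s : Fin (n + 1) → Bool) = abVec (Fin.cons false t) := h
  rw [hst, ht] at hs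
  simp only [Fin.cons_zero, Fin.cons_succ] at hs
  revert hs
  cases s i <;> cases t i <;> simp

theorem setOf_abVec_eq_range (n : ℕ) :
    {π : Fin (n + 1) → ℕ | ∃ x : Fin (n + 1) → Bool, abVec x = π} =
      Set.range fun t : Fin n → Bool => abVec (Fin.cons false t : Fin (n + 1) → Bool) := by
  ext π
  constructor
  · rintro ⟨x, rfl⟩
    cases hx : x 0
    · exact ⟨Fin.tail x, by simp only [← hx, Fin.cons_self_tail]⟩
    · refine ⟨Fin.tail fun i => !x i, ?_⟩
      have h : false = (fun i => !x i) 0 := by simp [hx]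
      simp only [h]
      rw [Fin.cons_self_tail (fun i => !x i), abVec_not]
  · rintro ⟨t, rfl⟩
    exact ⟨_, rfl⟩

/-- The number of distinct valid abelian border arrays of length `n ≥ 1` is `2 ^ (n-1)`. -/
theorem stmt_4 (n : ℕ) (hn : 1 ≤ n) :
    {π : Fin n → ℕ | ∃ x : Fin n → Bool, abVec x = π}.ncard = 2 ^ (n - 1) := by
  obtain ⟨n, rfl⟩ := Nat.exists_eq_add_of_le' hn
  rw [setOf_abVec_eq_range, ← Set.image_univ,
    Set.ncard_image_of_injective _ (abVec_cons_false_injective n), Set.ncard_univ]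
  simp
end
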